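/- Let H be a real Hilbert space and let G : H → H be a weakly continuous mapping for which there exist constants α, β > 0 such that ⟨G u, u⟩ ≥ α‖u‖² − β for all u ∈ H. Then for every f ∈ H there exists u₀ ∈ H such that ⟨G u₀ − f, v⟩ = 0 for all v ∈ H; equivalently, G u₀ = f. -/

import Mathlib

open Filter Topology

section NoRetraction

open MeasureTheory Metric
open scoped NNReal

/-- A Lipschitz function on a closed set that vanishes on its frontier stays Lipschitz, with the
same constant, when it is extended by zero. -/
theorem LipschitzOnWith.lipschitzWith_indicator {E F : Type*} [NormedAddCommGroup E]
    [NormedSpace ℝ E] [NormedAddCommGroup F] {s : Set E} {h : E → F} {C : ℝ≥0}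
    (hs : IsClosed s) (hh : LipschitzOnWith C h s) (h0 : ∀ x ∈ frontier s, h x = 0) :
    LipschitzWith C (s.indicator h) := by
  have key : ∀ x ∈ s, ∀ y ∉ s, dist (h x) 0 ≤ C * dist x y := by
    intro x hx y hy
    obtain ⟨z, hz, hzf⟩ : ∃ z ∈ segment ℝ x y, z ∈ frontier s := by
      by_contra! hno
      have hcover : segment ℝ x y ⊆ interior s ∪ sᶜ := fun z hz => by
        by_cases hzs : z ∈ s
        · exact Or.inl (by_contra fun hzi => hno z hz (hs.frontier_eq ▸ ⟨hzs, hzi⟩))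
        · exact Or.inr hzs
      obtain ⟨z, -, hz1, hz2⟩ := (convex_segment x y).isPreconnected _ _ isOpen_interior
        hs.isOpen_compl hcover
        ⟨x, left_mem_segment ℝ x y, (hcover (left_mem_segment ℝ x y)).resolve_right (by simpa)⟩
        ⟨y, right_mem_segment ℝ x y, hy⟩
      exact hz2 (interior_subset hz1)
    have h1 := hh.dist_le_mul x hx z (hs.frontier_subset hzf)
    rw [h0 z hzf] at h1
    refine h1.trans ?_
    gcongr
    have := dist_add_dist_of_mem_segment hz
    linarith [dist_nonneg (x := z) (y := y)]
  refine LipschitzWith.of_dist_le_mul fun x y => ?_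
  by_cases hx : x ∈ s <;> by_cases hy : y ∈ s
  · simpa [hx, hy] using hh.dist_le_mul x hx y hy
  · simpa [hx, hy] using key x hx y hy
  · simpa [hx, hy, dist_comm] using key y hy x hx
  · simp only [Set.indicator_of_notMem hx, Set.indicator_of_notMem hy, dist_self]
    positivity

/-- A perturbation of the identity by a contraction is bijective. -/
theorem LipschitzWith.bijective_id_add {E : Type*} [NormedAddCommGroup E] [CompleteSpace E]
    {φ : E → E} {K : ℝ≥0} (hφ : LipschitzWith K φ) (hK : K < 1) :
    Function.Bijective fun x => x + φ x := by
  constructor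
  · intro x y hxy
    have h1 := hφ.dist_le_mul x y
    have h2 : dist x y = dist (φ x) (φ y) := by
      have : x - y = φ y - φ x := by
        rw [sub_eq_sub_iff_add_eq_add]
        simpa [add_comm] using hxy
      rw [dist_eq_norm, this, ← dist_eq_norm, dist_comm]
    have h3 : (K : ℝ) < 1 := by exact_mod_cast hK
    by_contra hne
    have := dist_pos.2 hne
    nlinarith
  · intro y
    have hc : ContractingWith K fun x => y - φ x :=
      ⟨hK, LipschitzWith.of_dist_le_mul fun a b =>
        (dist_sub_left y (φ a) (φ b)).trans_le (hφ.dist_le_mul a b)⟩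
    refine ⟨hc.fixedPoint _, ?_⟩
    have h1 : y - φ (hc.fixedPoint _) = hc.fixedPoint _ := hc.fixedPoint_isFixedPt
    exact (sub_eq_iff_eq_add.1 h1).symm

/-- A small perturbation of the identity that maps a closed set to itself and fixes its frontier
is a bijection of that set. -/
theorem LipschitzOnWith.bijOn_id_add {E : Type*} [NormedAddCommGroup E] [NormedSpace ℝ E]
    [CompleteSpace E] {s : Set E} {φ : E → E} {K : ℝ≥0} (hs : IsClosed s)
    (hφ : LipschitzOnWith K φ s) (hK : K < 1) (h0 : ∀ x ∈ frontier s, φ x = 0)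
    (hmaps : Set.MapsTo (fun x => x + φ x) s s) :
    Set.BijOn (fun x => x + φ x) s s := by
  have hb := (hφ.lipschitzWith_indicator hs h0).bijective_id_add hK
  refine ⟨hmaps, fun x hx y hy hxy => hb.1 (by simpa [hx, hy] using hxy), fun y hy => ?_⟩
  obtain ⟨x, rfl⟩ := hb.2 y
  by_cases hx : x ∈ s
  · exact ⟨x, hx, by simp [hx]⟩
  · simp [hx] at hy

/-- `s ↦ det (1 + s L)` is a polynomial of degree at most the dimension, hence is recovered by
Lagrange interpolation. -/
theorem ContinuousLinearMap.det_one_add_smul_eq_sum {E : Type*} [NormedAddCommGroup E]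
    [NormedSpace ℝ E] [FiniteDimensional ℝ E] (L : E →L[ℝ] E) {t : ℕ → ℝ}
    (ht : Function.Injective t) (a : ℝ) :
    (1 + a • L).det = ∑ i ∈ Finset.range (Module.finrank ℝ E + 1),
      (1 + t i • L).det *
        (Lagrange.basis (Finset.range (Module.finrank ℝ E + 1)) t i).eval a := by
  classical
  let b := Module.finBasis ℝ E
  let A := LinearMap.toMatrix b b (L : E →ₗ[ℝ] E)
  let p : Polynomial ℝ :=
    ((Polynomial.X : Polynomial ℝ) • A.map Polynomial.C +
      (1 : Matrix _ _ ℝ).map Polynomial.C).det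
  have hp : ∀ c : ℝ, p.eval c = (1 + c • L).det := by
    intro c
    rw [ContinuousLinearMap.det, ← LinearMap.det_toMatrix b, ← Polynomial.coe_evalRingHom,
      RingHom.map_det]
    congr 1
    ext i j
    simp [A, Matrix.one_apply, add_comm, LinearMap.toMatrix_apply, Finsupp.single_apply, eq_comm]
    split_ifs <;> simp [mul_comm]
  have hdeg : p.degree < (Finset.range (Module.finrank ℝ E + 1)).card := by
    refine Polynomial.degree_le_natDegree.trans_lt ?_
    have := Polynomial.natDegree_det_X_add_C_le A 1
    rw [Fintype.card_fin] at this
    rw [Finset.card_range]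
    exact_mod_cast Nat.lt_succ_of_le this
  rw [← hp, Lagrange.eq_interpolate (ht.injOn) hdeg]
  simp [Lagrange.interpolate_apply, Polynomial.eval_finsetSum, hp]

/-- **No-retraction theorem**, for maps of class `C¹`: a sphere is not a retract of its ball. -/
theorem not_contDiff_retraction_sphere {E : Type*} [NormedAddCommGroup E]
    [InnerProductSpace ℝ E] [FiniteDimensional ℝ E] {ρ : ℝ} (hρ : 0 < ρ) {r : E → E}
    (hr : ContDiff ℝ 1 r) (hnorm : ∀ x, ‖r x‖ = ρ) (hfix : ∀ x, ‖x‖ = ρ → r x = x) : False := by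
  let : MeasurableSpace E := borel E
  have : BorelSpace E := ⟨rfl⟩
  let μ : Measure E := Measure.addHaar
  set B : Set E := closedBall 0 ρ with hB
  have hBc : IsCompact B := isCompact_closedBall 0 ρ
  let L : E → E →L[ℝ] E := fun x => fderiv ℝ r x - 1
  have hLcont : Continuous L := (hr.continuous_fderiv one_ne_zero).sub continuous_const
  have hh : ∀ x, HasFDerivAt (fun x => r x - x) (L x) x := fun x =>
    ((hr.differentiable one_ne_zero) x).hasFDerivAt.sub (hasFDerivAt_id x)
  have hdet : ∀ x, (fderiv ℝ r x).det = 0 := by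
    intro x
    by_contra hne
    have hsurj : Function.Surjective (fderiv ℝ r x) :=
      ((LinearMap.equivOfDetNeZero _ hne).surjective :)
    obtain ⟨v, hv⟩ := hsurj (r x)
    have h1 : HasFDerivAt (fun y => inner ℝ (r y) (r y)) _ x :=
      (((hr.differentiable one_ne_zero) x).hasFDerivAt).inner ℝ
        (((hr.differentiable one_ne_zero) x).hasFDerivAt)
    have h2 : (fun y => inner ℝ (r y) (r y)) = fun _ => ρ ^ 2 := by
      funext y
      rw [real_inner_self_eq_norm_sq, hnorm]
    rw [h2] at h1
    have h3 := congrArg (fun l => l v) (h1.unique (hasFDerivAt_const _ _))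
    simp [hv, hnorm] at h3
    exact hρ.ne' h3
  obtain ⟨C, hC⟩ := hBc.exists_bound_of_continuousOn hLcont.continuousOn
  have hC0 : 0 ≤ C := (norm_nonneg _).trans (hC 0 (mem_closedBall_self hρ.le))
  obtain ⟨ε, hε, hpos⟩ : ∃ ε > 0, ∀ A : E →L[ℝ] E, ‖A - 1‖ < ε → 0 < A.det := by
    have h1 : ∀ᶠ A : E →L[ℝ] E in 𝓝 1, 0 < A.det :=
      ContinuousLinearMap.continuous_det.continuousAt.eventually
        (lt_mem_nhds (by simp [ContinuousLinearMap.det]))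
    obtain ⟨ε, hε, h⟩ := Metric.eventually_nhds_iff.1 h1
    exact ⟨ε, hε, fun A hA => h (by rwa [dist_eq_norm])⟩
  have key : ∀ t : ℝ, 0 < t → t ≤ 1 → t * C < 1 → t * C < ε →
      ∫ x in B, (1 + t • L x).det ∂μ = μ.real B := by
    intro t ht ht1 htC htε
    have hlip : LipschitzOnWith (Real.toNNReal (t * C)) (fun x => t • (r x - x)) B := by
      refine (convex_closedBall 0 ρ).lipschitzOnWith_of_nnnorm_hasFDerivWithin_le
        (fun x _ => ((hh x).const_smul t).hasFDerivWithinAt) fun x hx => ?_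
      rw [← NNReal.coe_le_coe, coe_nnnorm, norm_smul, Real.norm_of_nonneg ht.le,
        Real.coe_toNNReal _ (by positivity)]
      gcongr
      exact hC x hx
    have hbij : Set.BijOn (fun x => x + t • (r x - x)) B B := by
      refine hlip.bijOn_id_add isClosed_closedBall (by simpa using htC) (fun x hx => ?_)
        fun x hx => ?_
      · rw [hfix x (by simpa using frontier_closedBall_subset_sphere hx), sub_self, smul_zero]
      · have h1 : x + t • (r x - x) = (1 - t) • x + t • r x := by module
        have h2 : r x ∈ B := by simp [hB, hnorm]
        have h3 := convex_closedBall (0 : E) ρ hx h2 (sub_nonneg.2 ht1) ht.le (by ring)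
        simpa only [h1] using h3
    have hcov := integral_image_eq_integral_abs_det_fderiv_smul μ
      (f' := fun x => 1 + t • L x) (isClosed_closedBall (x := (0 : E)) (ε := ρ)).measurableSet
      (fun x _ => ((hasFDerivAt_id x).add ((hh x).const_smul t)).hasFDerivWithinAt)
      hbij.injOn (fun _ => (1 : ℝ))
    have himg : (id + t • fun x => r x - x) '' B = B := hbij.image_eq
    rw [himg] at hcov
    simp only [integral_const, smul_eq_mul, mul_one] at hcov
    rw [show μ.real B = (μ.restrict B).real Set.univ by simp, hcov]
    refine setIntegral_congr_fun hBc.measurableSet fun x hx => (abs_of_pos (hpos _ ?_)).symm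
    rw [add_sub_cancel_left, norm_smul, Real.norm_of_nonneg ht.le]
    exact (mul_le_mul_of_nonneg_left (hC x hx) ht.le).trans_lt htε
  obtain ⟨δ, hδ, hδ1, hδC, hδε⟩ : ∃ δ : ℝ, 0 < δ ∧ δ ≤ 1 ∧ δ * C < 1 ∧ δ * C < ε := by
    refine ⟨min 1 ε / (C + 1), by positivity, ?_, ?_, ?_⟩
    · rw [div_le_one (by positivity)]
      linarith [min_le_left 1 ε]
    all_goals
      rw [div_mul_eq_mul_div, div_lt_iff₀ (by positivity)]
      nlinarith [min_le_left 1 ε, min_le_right 1 ε, lt_min one_pos hε]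
  let t : ℕ → ℝ := fun i => δ / (i + 1)
  have htinj : Function.Injective t := by
    intro i j hij
    have : (i : ℝ) + 1 = j + 1 := by
      have := congrArg (fun z => δ / z) hij
      simpa [t, div_div_cancel₀ hδ.ne'] using this
    exact_mod_cast add_right_cancel this
  have ht0 : ∀ i, 0 < t i := fun i => by positivity
  have htδ : ∀ i, t i ≤ δ := fun i => div_le_self hδ.le (by simp)
  have hval : ∀ i, ∫ x in B, (1 + t i • L x).det ∂μ = μ.real B := fun i =>
    key _ (ht0 i) ((htδ i).trans hδ1)
      ((mul_le_mul_of_nonneg_right (htδ i) hC0).trans_lt hδC)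
      ((mul_le_mul_of_nonneg_right (htδ i) hC0).trans_lt hδε)
  have hint : ∀ i, IntegrableOn (fun x => (1 + t i • L x).det) B μ := fun i =>
    (ContinuousLinearMap.continuous_det.comp
      (continuous_const.add (hLcont.const_smul (t i)))).continuousOn.integrableOn_compact hBc
  have hzero : ∫ x in B, (1 + (1 : ℝ) • L x).det ∂μ = 0 := by simp [L, hdet]
  rw [funext fun x => (L x).det_one_add_smul_eq_sum htinj 1,
    integral_finsetSum _ fun i _ => (hint i).mul_const _] at hzero
  simp only [integral_mul_const, hval] at hzero
  rw [← Finset.mul_sum, ← Polynomial.eval_finsetSum,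
    Lagrange.sum_basis htinj.injOn (by simp), Polynomial.eval_one, mul_one] at hzero
  have : 0 < μ.real B := ENNReal.toReal_pos (measure_closedBall_pos μ 0 hρ).ne'
    hBc.measure_lt_top.ne
  exact this.ne' hzero

/-- A continuous vector field on a finite-dimensional space that points outwards far from the
origin has a zero. -/
theorem exists_eq_zero_of_norm_le_inner {E : Type*} [NormedAddCommGroup E]
    [InnerProductSpace ℝ E] [FiniteDimensional ℝ E] {F : E → E} (hF : Continuous F) {R : ℝ}
    (hR : 0 < R) (hout : ∀ x, R ≤ ‖x‖ → ‖x‖ ≤ inner ℝ (F x) x) : ∃ x, F x = 0 := by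
  by_contra! hne
  obtain ⟨g, hg, hgF, -⟩ := hF.exists_contDiff_approx 1
    (ε := fun x => min ‖F x‖ 1) (by fun_prop) fun x => lt_min (norm_pos_iff.2 (hne x)) one_pos
  have hg0 : ∀ x, g x ≠ 0 := fun x hx => by
    have := (hgF x).trans_le (min_le_left _ _)
    simp [hx] at this
  have hgout : ∀ x, R ≤ ‖x‖ → 0 < inner ℝ (g x) x := fun x hx => by
    have h1 : ‖g x - F x‖ < 1 := dist_eq_norm (g x) (F x) ▸ (hgF x).trans_le (min_le_right _ _)
    have h2 := neg_le_of_abs_le (abs_real_inner_le_norm (g x - F x) x)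
    have h3 := hout x hx
    rw [inner_sub_left] at h2
    nlinarith [hR.trans_le hx]
  let χ : ContDiffBump (0 : E) := ⟨R, 2 * R, hR, by linarith⟩
  let k : E → E := fun x => χ x • g x + (1 - χ x) • x
  have hk : ContDiff ℝ 1 k :=
    (χ.contDiff.smul hg).add ((contDiff_const.sub χ.contDiff).smul contDiff_id)
  have hk0 : ∀ x, k x ≠ 0 := fun x hx => by
    rcases lt_or_ge ‖x‖ R with h | h
    · have : χ x = 1 := χ.one_of_mem_closedBall (by simpa using h.le)
      simp [k, this, hg0] at hx
    · have h1 : inner ℝ (k x) x = χ x * inner ℝ (g x) x + (1 - χ x) * ‖x‖ ^ 2 := by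
        simp [k, inner_add_left, real_inner_smul_left]
      rw [hx, inner_zero_left] at h1
      have h2 := hgout x h
      have h3 : 0 < ‖x‖ ^ 2 := pow_pos (hR.trans_le h) 2
      have h4 := χ.nonneg (x := x)
      have h5 := χ.le_one (x := x)
      rcases h4.eq_or_lt with h6 | h6
      · rw [← h6] at h1
        linarith
      · nlinarith
  refine not_contDiff_retraction_sphere (r := fun x => (2 * R / ‖k x‖) • k x)
    (show 0 < 2 * R by positivity) ((contDiff_const.div (hk.norm ℝ hk0)
      fun x => norm_ne_zero_iff.2 (hk0 x)).smul hk) (fun x => ?_) fun x hx => ?_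
  · rw [norm_smul, norm_div, norm_norm, div_mul_cancel₀ _ (norm_ne_zero_iff.2 (hk0 x)),
      Real.norm_of_nonneg (by positivity)]
  · have h1 : χ x = 0 := χ.zero_of_le_dist (by simp [χ, hx])
    have h2 : k x = x := by simp [k, h1]
    rw [h2, hx, div_self (by positivity), one_smul]

end NoRetraction

/-- Bounded sequences in a separable Hilbert space have weakly convergent subsequences. -/
theorem exists_subseq_tendsto_inner {H : Type*} [NormedAddCommGroup H] [InnerProductSpace ℝ H]
    [CompleteSpace H] [TopologicalSpace.SeparableSpace H] {u : ℕ → H} {R : ℝ}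
    (hu : ∀ n, ‖u n‖ ≤ R) :
    ∃ (u₀ : H) (φ : ℕ → ℕ), StrictMono φ ∧
      ∀ v : H, Tendsto (fun n => inner ℝ (u (φ n)) v) atTop (𝓝 (inner ℝ u₀ v)) := by
  obtain ⟨ℓ, -, φ, hφ, hlim⟩ := WeakDual.isSeqCompact_closedBall ℝ H 0 R
    (x := fun n => StrongDual.toWeakDual (InnerProductSpace.toDual ℝ H (u n)))
    fun n => by simpa using hu n
  refine ⟨(InnerProductSpace.toDual ℝ H).symm (WeakDual.toStrongDual ℓ), φ, hφ, fun v => ?_⟩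
  rw [InnerProductSpace.toDual_symm_apply]
  exact ((WeakDual.eval_continuous v).tendsto ℓ).comp hlim

/-- A sequentially weakly continuous coercive map admits Galerkin solutions in every
finite-dimensional subspace. -/
theorem exists_mem_forall_inner_sub_eq_zero {H : Type*} [NormedAddCommGroup H]
    [InnerProductSpace ℝ H] {G : H → H}
    (hweak : ∀ (u : ℕ → H) (u₀ : H),
      (∀ v : H, Tendsto (fun n => inner ℝ (u n) v) atTop (𝓝 (inner ℝ u₀ v))) →
      ∀ v : H, Tendsto (fun n => inner ℝ (G (u n)) v) atTop (𝓝 (inner ℝ (G u₀) v)))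
    {f : H} {R : ℝ} (hR : 0 < R) (hout : ∀ u : H, R ≤ ‖u‖ → ‖u‖ ≤ inner ℝ (G u - f) u)
    (V : Submodule ℝ H) [FiniteDimensional ℝ V] :
    ∃ u ∈ V, ‖u‖ ≤ R ∧ ∀ v ∈ V, inner ℝ (G u - f) v = 0 := by
  let b := stdOrthonormalBasis ℝ V
  let F : V → V := fun u => ∑ i, inner ℝ (G u - f) (b i : H) • b i
  have hFinner : ∀ u v : V, inner ℝ (F u) v = inner ℝ (G u - f) (v : H) := fun u v => by
    conv_rhs => rw [← b.sum_repr v]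
    simp only [F, sum_inner, real_inner_smul_left, Submodule.coe_sum, Submodule.coe_smul,
      inner_sum, real_inner_smul_right, b.repr_apply_apply]
    exact Finset.sum_congr rfl fun i _ => mul_comm _ _
  have hFcont : Continuous F := by
    refine continuous_finsetSum _ fun i _ => Continuous.fun_smul ?_ continuous_const
    refine SeqContinuous.continuous fun x p hx => ?_
    simp only [Function.comp_def, inner_sub_left]
    refine (hweak (fun n => (x n : H)) p (fun v => ?_) _).sub_const _
    exact ((continuous_subtype_val.inner continuous_const).tendsto p).comp hx
  have hFout : ∀ u : V, R ≤ ‖u‖ → ‖u‖ ≤ inner ℝ (F u) u := fun u hu => by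
    rw [hFinner]
    exact hout u hu
  obtain ⟨u, hu⟩ := exists_eq_zero_of_norm_le_inner hFcont hR hFout
  refine ⟨u, u.2, ?_, fun v hv => ?_⟩
  · by_contra! h
    have h1 := hFout u h.le
    rw [hu, inner_zero_left] at h1
    exact absurd (hR.trans h) h1.not_gt
  · rw [← hFinner u ⟨v, hv⟩, hu, inner_zero_left]

/-- Coercivity `⟪G u, u⟫ ≥ α‖u‖² − β` makes `G - f` point outwards outside some ball. -/
theorem exists_norm_le_inner_sub {H : Type*} [NormedAddCommGroup H] [InnerProductSpace ℝ H]
    {G : H → H} {α β : ℝ} (hα : 0 < α) (hβ : 0 < β)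
    (hcoer : ∀ u : H, α * ‖u‖ ^ 2 - β ≤ inner ℝ (G u) u) (f : H) :
    ∃ R > 0, ∀ u : H, R ≤ ‖u‖ → ‖u‖ ≤ inner ℝ (G u - f) u := by
  refine ⟨(‖f‖ + 1 + β) / α + 1, by positivity, fun u hu => ?_⟩
  have h1 : 1 ≤ ‖u‖ := le_trans (le_add_of_nonneg_left (by positivity)) hu
  have h2 : ‖f‖ + 1 + β ≤ α * ‖u‖ := by
    rw [mul_comm, ← div_le_iff₀ hα]
    linarith
  have h3 := real_inner_le_norm f u
  rw [inner_sub_left]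
  nlinarith [hcoer u]

/-- The acute-angle principle in separable spaces. -/
theorem exists_eq_of_coercive_of_separable {H : Type*} [NormedAddCommGroup H]
    [InnerProductSpace ℝ H] [CompleteSpace H] [TopologicalSpace.SeparableSpace H] {G : H → H}
    (hweak : ∀ (u : ℕ → H) (u₀ : H),
      (∀ v : H, Tendsto (fun n => inner ℝ (u n) v) atTop (𝓝 (inner ℝ u₀ v))) →
      ∀ v : H, Tendsto (fun n => inner ℝ (G (u n)) v) atTop (𝓝 (inner ℝ (G u₀) v)))
    {α β : ℝ} (hα : 0 < α) (hβ : 0 < β)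
    (hcoer : ∀ u : H, α * ‖u‖ ^ 2 - β ≤ inner ℝ (G u) u) (f : H) : ∃ u₀, G u₀ = f := by
  obtain ⟨R, hR, hout⟩ := exists_norm_le_inner_sub hα hβ hcoer f
  let V : ℕ → Submodule ℝ H := fun n =>
    Submodule.span ℝ (TopologicalSpace.denseSeq H '' Set.Iic n)
  have hVfin : ∀ n, FiniteDimensional ℝ (V n) := fun n =>
    FiniteDimensional.span_of_finite ℝ ((Set.finite_Iic n).image _)
  choose u _ huR hu using fun n => exists_mem_forall_inner_sub_eq_zero hweak hR hout (V n)
  obtain ⟨u₀, φ, hφ, hlim⟩ := exists_subseq_tendsto_inner huR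
  refine ⟨u₀, sub_eq_zero.1 ?_⟩
  have hdense : ∀ m, inner ℝ (G u₀ - f) (TopologicalSpace.denseSeq H m) = 0 := fun m => by
    have h1 := (hweak _ _ hlim (TopologicalSpace.denseSeq H m)).sub_const
      (inner ℝ f (TopologicalSpace.denseSeq H m))
    simp only [← inner_sub_left] at h1
    refine tendsto_nhds_unique h1 (tendsto_const_nhds.congr' ?_)
    filter_upwards [eventually_ge_atTop m] with n hn
    exact (hu (φ n) _ (Submodule.subset_span ⟨m, hn.trans hφ.le_apply, rfl⟩)).symm
  have hall : (fun v => inner ℝ (G u₀ - f) v) = fun _ => (0 : ℝ) :=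
    Continuous.ext_on (TopologicalSpace.denseRange_denseSeq H) (by fun_prop) continuous_const
      (by rintro _ ⟨m, rfl⟩; exact hdense m)
  exact inner_self_eq_zero.1 (congrFun hall _)

/-- A sequentially weakly continuous map sends the closure of a set into every closed subspace that
contains the image of the set. -/
theorem map_mem_of_mem_closure_of_weak_continuous {H : Type*} [NormedAddCommGroup H]
    [InnerProductSpace ℝ H] [CompleteSpace H] {G : H → H}
    (hweak : ∀ (u : ℕ → H) (u₀ : H),
      (∀ v : H, Tendsto (fun n => inner ℝ (u n) v) atTop (𝓝 (inner ℝ u₀ v))) →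
      ∀ v : H, Tendsto (fun n => inner ℝ (G (u n)) v) atTop (𝓝 (inner ℝ (G u₀) v)))
    {D : Set H} {K : Submodule ℝ H} (hK : IsClosed (K : Set H)) (hD : ∀ d ∈ D, G d ∈ K) {x : H}
    (hx : x ∈ closure D) : G x ∈ K := by
  obtain ⟨d, hdD, hd⟩ := mem_closure_iff_seq_limit.1 hx
  have : CompleteSpace K := hK.completeSpace_coe
  rw [← K.orthogonal_orthogonal, Submodule.mem_orthogonal']
  intro w hw
  have h1 := hweak d x (fun v => hd.inner tendsto_const_nhds) w
  have h2 : ∀ n, inner ℝ (G (d n)) w = 0 := fun n =>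
    Submodule.inner_right_of_mem_orthogonal (hD _ (hdD n)) hw
  simp only [h2] at h1
  exact tendsto_nhds_unique h1 tendsto_const_nhds

/-- Every vector lies in a separable closed subspace that is invariant under a given sequentially
weakly continuous map. -/
theorem exists_countable_topologicalClosure_span_invariant {H : Type*} [NormedAddCommGroup H]
    [InnerProductSpace ℝ H] [CompleteSpace H] {G : H → H}
    (hweak : ∀ (u : ℕ → H) (u₀ : H),
      (∀ v : H, Tendsto (fun n => inner ℝ (u n) v) atTop (𝓝 (inner ℝ u₀ v))) →
      ∀ v : H, Tendsto (fun n => inner ℝ (G (u n)) v) atTop (𝓝 (inner ℝ (G u₀) v)))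
    (f : H) :
    ∃ C : Set H, C.Countable ∧ f ∈ (Submodule.span ℝ C).topologicalClosure ∧
      ∀ x ∈ (Submodule.span ℝ C).topologicalClosure,
        G x ∈ (Submodule.span ℝ C).topologicalClosure := by
  have step : ∀ C : {C : Set H // C.Countable}, ∃ C' : {C : Set H // C.Countable},
      C.1 ⊆ C'.1 ∧ ∀ x ∈ Submodule.span ℝ C.1,
        G x ∈ (Submodule.span ℝ C'.1).topologicalClosure := by
    rintro ⟨C, hC⟩
    obtain ⟨D, -, hD, hCD⟩ :=
      (hC.isSeparable.span (R := ℝ)).exists_countable_dense_subset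
    refine ⟨⟨C ∪ G '' D, hC.union (hD.image G)⟩, Set.subset_union_left, fun x hx => ?_⟩
    exact map_mem_of_mem_closure_of_weak_continuous hweak
      (Submodule.isClosed_topologicalClosure _)
      (fun d hd => Submodule.le_topologicalClosure _ (Submodule.subset_span
        (Or.inr ⟨d, hd, rfl⟩))) (hCD hx)
  choose next hnext hG using step
  let C : ℕ → {C : Set H // C.Countable} := fun n =>
    Nat.rec ⟨{f}, Set.countable_singleton f⟩ (fun _ => next) n
  have hmono : Monotone fun n => (C n).1 := monotone_nat_of_le_succ fun n => hnext (C n)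
  refine ⟨⋃ n, (C n).1, Set.countable_iUnion fun n => (C n).2,
    Submodule.le_topologicalClosure _ (Submodule.subset_span (Set.mem_iUnion.2 ⟨0, rfl⟩)),
    fun x hx => ?_⟩
  refine map_mem_of_mem_closure_of_weak_continuous hweak
    (D := (Submodule.span ℝ (⋃ n, (C n).1) : Set H)) (Submodule.isClosed_topologicalClosure _)
    (fun d hd => ?_) hx
  rw [SetLike.mem_coe, Submodule.span_iUnion, Submodule.mem_iSup_of_directed _
    (Monotone.directed_le fun i j hij => Submodule.span_mono (hmono hij))] at hd
  obtain ⟨n, hn⟩ := hd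
  exact Submodule.topologicalClosure_mono
    (Submodule.span_mono (Set.subset_iUnion (fun n => (C n).1) (n + 1))) (hG (C n) d hn)

/-- **Acute-angle principle.** If `G : H → H` is weakly continuous on a real Hilbert
space `H` and satisfies the coercivity condition `⟪G u, u⟫ ≥ α‖u‖² − β`, then for any
`f ∈ H` there is `u₀ ∈ H` with `⟪G u₀ − f, v⟫ = 0` for all `v ∈ H`. -/
theorem acute_angle_principle
    {H : Type*} [NormedAddCommGroup H] [InnerProductSpace ℝ H] [CompleteSpace H]
    (G : H → H)
    (hweak : ∀ (u : ℕ → H) (u₀ : H),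
      (∀ v : H, Tendsto (fun n => (inner ℝ (u n) v : ℝ)) atTop (𝓝 (inner ℝ u₀ v : ℝ))) →
      ∀ v : H, Tendsto (fun n => (inner ℝ (G (u n)) v : ℝ)) atTop (𝓝 (inner ℝ (G u₀) v : ℝ)))
    (α β : ℝ) (hα : 0 < α) (hβ : 0 < β)
    (hcoer : ∀ u : H, (inner ℝ (G u) u : ℝ) ≥ α * ‖u‖ ^ 2 - β)
    (f : H) :
    ∃ u₀ : H, ∀ v : H, (inner ℝ (G u₀ - f) v : ℝ) = 0 := by
  obtain ⟨C, hC, hfC, hGC⟩ := exists_countable_topologicalClosure_span_invariant hweak f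
  set V := (Submodule.span ℝ C).topologicalClosure
  have : CompleteSpace V := Submodule.isClosed_topologicalClosure _ |>.completeSpace_coe
  have : TopologicalSpace.SeparableSpace V :=
    (hC.isSeparable.span (R := ℝ)).closure.separableSpace
  let T : V → V := fun u => ⟨G u, hGC u u.2⟩
  have hT : ∀ (u : ℕ → V) (u₀ : V),
      (∀ v : V, Tendsto (fun n => inner ℝ (u n) v) atTop (𝓝 (inner ℝ u₀ v))) →
      ∀ v : V, Tendsto (fun n => inner ℝ (T (u n)) v) atTop (𝓝 (inner ℝ (T u₀) v)) := by
    intro u u₀ hu v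
    refine hweak (fun n => (u n : H)) u₀ (fun w => ?_) v
    simpa using hu (V.orthogonalProjectionOnto w)
  obtain ⟨u, hu⟩ := exists_eq_of_coercive_of_separable hT hα hβ (fun u => hcoer u) ⟨f, hfC⟩
  have hGu : G u = f := congrArg Subtype.val hu
  exact ⟨u, fun v => by rw [hGu, sub_self, inner_zero_left]⟩
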